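/- The comultiplication of the twisted Lee Frobenius algebra commutes with the left and right actions of the algebra (the Frobenius condition): for every commutative ring R and all a, b ∈ A_TLee = R[X]/(X² − X), one has Δ_TLee(a·b) = (a ⊗ 1)·Δ_TLee(b) = Δ_TLee(a)·(1 ⊗ b), where A_TLee ⊗_R A_TLee carries its ring structure with componentwise multiplication. -/

import Mathlib

open Polynomial TensorProduct

noncomputable section

/-- The twisted Lee Frobenius algebra `A_TLee = R[X]/(X² − X)`. -/
abbrev ATLee (R : Type*) [CommRing R] := R[X] ⧸ Ideal.span {(X : R[X]) ^ 2 - X}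

/-- The class of `X` in `A_TLee`. -/
def XTLee (R : Type*) [CommRing R] : ATLee R :=
  Ideal.Quotient.mk (Ideal.span {(X : R[X]) ^ 2 - X}) X

theorem XTLee_mul_self (R : Type*) [CommRing R] : XTLee R * XTLee R = XTLee R := by
  rw [XTLee, ← map_mul, ← pow_two]
  exact Ideal.Quotient.eq.mpr (Ideal.mem_span_singleton_self _)

theorem ATLee.exists_eq_smul_one_add_smul_XTLee {R : Type*} [CommRing R] (a : ATLee R) :
    ∃ r s : R, a = r • (1 : ATLee R) + s • XTLee R := by
  obtain ⟨p, rfl⟩ := Ideal.Quotient.mk_surjective a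
  induction p using Polynomial.induction_on with
  | C r => exact ⟨r, 0, by rw [zero_smul, add_zero, ← Algebra.algebraMap_eq_smul_one]; rfl⟩
  | add p q hp hq =>
    obtain ⟨r, s, hp⟩ := hp
    obtain ⟨t, u, hq⟩ := hq
    exact ⟨r + t, s + u, by rw [map_add, hp, hq]; module⟩
  | monomial n r h =>
    obtain ⟨t, u, h⟩ := h
    refine ⟨0, t + u, ?_⟩
    rw [pow_succ X n, ← mul_assoc, map_mul, h, ← XTLee, add_mul, smul_mul_assoc, smul_mul_assoc,
      one_mul, XTLee_mul_self]
    module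

theorem comul_mul_of_isIdempotentElem {R A : Type*} [CommRing R] [CommRing A] [Algebra R A] {x : A}
    (hx : IsIdempotentElem x) (Δ : A →ₗ[R] A ⊗[R] A)
    (h1 : Δ 1 = x ⊗ₜ[R] 1 + 1 ⊗ₜ[R] x - 1 ⊗ₜ[R] 1) (hΔx : Δ x = x ⊗ₜ[R] x) (r s t u : R) :
    Δ ((r • 1 + s • x) * (t • 1 + u • x)) =
        ((r • 1 + s • x) ⊗ₜ[R] 1) * Δ (t • 1 + u • x) ∧
      Δ ((r • 1 + s • x) * (t • 1 + u • x)) =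
        Δ (r • 1 + s • x) * (1 ⊗ₜ[R] (t • 1 + u • x)) := by
  constructor <;>
  · simp only [add_mul, mul_add, sub_mul, mul_sub, smul_mul_assoc, mul_smul_comm, map_add, map_smul,
      h1, hΔx, one_mul, mul_one, hx.eq, TensorProduct.add_tmul, TensorProduct.tmul_add,
      TensorProduct.tmul_smul, ← TensorProduct.smul_tmul', Algebra.TensorProduct.tmul_mul_tmul]
    module

/-- The comultiplication of the twisted Lee Frobenius algebra commutes with the left
and right actions of the algebra (Frobenius condition): for all `a b ∈ A_TLee`,
`Δ(a·b) = (a ⊗ 1)·Δ(b) = Δ(a)·(1 ⊗ b)`, where `A_TLee ⊗ A_TLee` carries the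
componentwise ring structure. -/
theorem tlee_comul_frobenius (R : Type*) [CommRing R]
    (Δ : ATLee R →ₗ[R] ATLee R ⊗[R] ATLee R)
    (h1 : Δ 1 = XTLee R ⊗ₜ[R] 1 + 1 ⊗ₜ[R] XTLee R - 1 ⊗ₜ[R] 1)
    (hX : Δ (XTLee R) = XTLee R ⊗ₜ[R] XTLee R) :
    ∀ a b : ATLee R,
      Δ (a * b) = (a ⊗ₜ[R] 1) * Δ b ∧ Δ (a * b) = Δ a * (1 ⊗ₜ[R] b) := by
  intro a b
  obtain ⟨r, s, rfl⟩ := a.exists_eq_smul_one_add_smul_XTLee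
  obtain ⟨t, u, rfl⟩ := b.exists_eq_smul_one_add_smul_XTLee
  exact comul_mul_of_isIdempotentElem (XTLee_mul_self R) Δ h1 hX r s t u
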